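/- arXiv:2201.12949 — 2 statements merged into one kernel-verified Lean document; each statement's English description precedes it below -/
import Mathlib

section
/- Let w be a permutation of {1,…,n} with w(i) = i for some index i. For a ≠ i write a' = a if a < i and a' = a − 1 if a > i. Then for every a ≠ i: if (a,i) (when a<i) or (i,a) (when a>i) is an inversion of w, then |fl_i(w)(a') − a'| = |w(a) − a| − 1; otherwise |fl_i(w)(a') − a'| = |w(a) − a|. -/
/-- The (Coxeter) length of a permutation: its number of inversions,
i.e. pairs `(a,b)` with `a < b` and `w a > w b`. -/
def invLen {n : ℕ} (w : Equiv.Perm (Fin n)) : ℕ :=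
  (Finset.univ.filter (fun p : Fin n × Fin n => p.1 < p.2 ∧ w p.2 < w p.1)).card

/-- The number of cycles in the cycle decomposition of `w`,
where fixed points count as cycles. -/
def numCycles {n : ℕ} (w : Equiv.Perm (Fin n)) : ℕ :=
  w.cycleType.card + (Finset.univ.filter (fun i : Fin n => w i = i)).card

/-- The reflection length of a permutation of `{1,…,n}`: `n` minus the number of
cycles in its cycle decomposition (fixed points counting as cycles). -/
def reflLen {n : ℕ} (w : Equiv.Perm (Fin n)) : ℕ :=
  n - numCycles w

/-- The total displacement `td(w) = Σ_i |w(i) - i|`. -/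
def totalDisp {n : ℕ} (w : Equiv.Perm (Fin n)) : ℕ :=
  ∑ i : Fin n, ((w i : ℤ) - (i : ℤ)).natAbs

/-- A permutation is shallow if `ℓ(w) + ℓ_T(w) = td(w)`. -/
def IsShallow {n : ℕ} (w : Equiv.Perm (Fin n)) : Prop :=
  invLen w + reflLen w = totalDisp w

/-- The `i`-th flattening of `w`: remove the `i`-th entry of the one-line notation
and renumber down by one every entry greater than `w i`.  Position `k` of `Fin n`
corresponds to position `i.succAbove k` of `Fin (n+1)`, and value `m` corresponds
to value `(w i).succAbove m`; this is implemented by deleting the point `i` from the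
source and `w i` from the target via `finSuccEquiv'`. -/
def flatten {n : ℕ} (w : Equiv.Perm (Fin (n + 1))) (i : Fin (n + 1)) : Equiv.Perm (Fin n) :=
  Equiv.removeNone ((finSuccEquiv' i).symm.trans (w.trans (finSuccEquiv' (w i))))

/-- `v` has a left-to-right maximum at position `j` if `v j > v i` for all `i < j`. -/
def LeftToRightMaxAt {m : ℕ} (v : Equiv.Perm (Fin m)) (j : Fin m) : Prop :=
  ∀ i : Fin m, i < j → v i < v j

/-- `v` has a right-to-left minimum at position `j` if `v j < v i` for all `i > j`. -/
def RightToLeftMinAt {m : ℕ} (v : Equiv.Perm (Fin m)) (j : Fin m) : Prop :=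
  ∀ i : Fin m, j < i → v j < v i

theorem succAbove_flatten {n : ℕ} (w : Equiv.Perm (Fin (n + 1))) (i : Fin (n + 1)) (k : Fin n) :
    (w i).succAbove (flatten w i k) = w (i.succAbove k) := by
  have hne : w (i.succAbove k) ≠ w i := w.injective.ne (Fin.succAbove_ne i k)
  obtain ⟨m, hm⟩ := Fin.exists_succAbove_eq hne
  have hsome : some (flatten w i k) =
      ((finSuccEquiv' i).symm.trans (w.trans (finSuccEquiv' (w i)))) (some k) :=
    Equiv.removeNone_some _ ⟨m, by simp [← hm]⟩
  have hval : flatten w i k = m := by simpa [← hm] using hsome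
  rw [hval, hm]

/-- Suppose `w i = i`.  For `a ≠ i`, write `a' = a` if `a < i` and `a' = a - 1` if `a > i`.
If `(a,i)` (when `a < i`) or `(i,a)` (when `a > i`) is an inversion of `w`, then
`|fl_i(w)(a') - a'| = |w a - a| - 1`; otherwise `|fl_i(w)(a') - a'| = |w a - a|`. -/
theorem abs_displacement_flatten_of_fixed {n : ℕ} (w : Equiv.Perm (Fin (n + 1)))
    (i : Fin (n + 1)) (hfix : w i = i) (a : Fin (n + 1)) (ha : a ≠ i) (a' : Fin n)
    (ha' : (a' : ℕ) = if (a : ℕ) < (i : ℕ) then (a : ℕ) else (a : ℕ) - 1) :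
    (((a < i ∧ w i < w a) ∨ (i < a ∧ w a < w i)) →
        |((flatten w i a' : ℤ)) - (a' : ℤ)| = |((w a : ℤ)) - (a : ℤ)| - 1)
    ∧ (¬((a < i ∧ w i < w a) ∨ (i < a ∧ w a < w i)) →
        |((flatten w i a' : ℤ)) - (a' : ℤ)| = |((w a : ℤ)) - (a : ℤ)|) := by
  have hpos : i.succAbove a' = a := by
    ext
    simp only [Fin.succAbove, Fin.lt_def, Fin.val_castSucc]
    split_ifs at ha' ⊢ <;> simp only [Fin.val_castSucc, Fin.val_succ] <;> omega
  have hflat := congrArg Fin.val (succAbove_flatten w i a')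
  have hne : (w a : ℕ) ≠ i := fun h => ha (w.injective ((Fin.ext h).trans hfix.symm))
  rw [hpos, hfix, Fin.succAbove] at hflat
  simp only [hfix, Fin.lt_def, Fin.val_castSucc, Int.abs_eq_natAbs] at hflat ⊢
  split_ifs at ha' hflat <;> simp only [Fin.val_castSucc, Fin.val_succ] at hflat <;> omega
end

section
/- Let n ≥ 2 and let w be a shallow permutation of {1,…,n}. Then either: (a) w(n) = n and the permutation w' of {1,…,n−1} defined by w'(i) = w(i) for all 1 ≤ i ≤ n−1 is shallow; or (b) w(n) = k ≠ n, j = w^{-1}(n), and the permutation w' of {1,…,n−1} defined by w'(i) = w(i) for i ∈ {1,…,n−1} with i ≠ j and w'(j) = k is shallow and has either a left-to-right maximum or a right-to-left minimum at position j. -/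
/-- A label for the cycle of `w` through `x`; two points get the same label exactly when they
lie in the same cycle. -/
def cycleLabel {n : ℕ} (w : Equiv.Perm (Fin n)) (x : Fin n) : Equiv.Perm (Fin n) ⊕ Fin n :=
  if w x = x then Sum.inr x else Sum.inl (w.cycleOf x)

theorem cycleLabel_apply {n : ℕ} (w : Equiv.Perm (Fin n)) (x : Fin n) :
    cycleLabel w (w x) = cycleLabel w x := by
  by_cases h : w x = x
  · rw [h]
  · have h' : w (w x) ≠ w x := fun e => h (w.injective e)
    have hs : w.SameCycle (w x) x := Equiv.Perm.sameCycle_apply_left.2 (Equiv.Perm.SameCycle.refl _ _)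
    simp [cycleLabel, h, hs.cycleOf_eq]

theorem sameCycle_of_cycleLabel_eq {n : ℕ} {w : Equiv.Perm (Fin n)} {x y : Fin n}
    (h : cycleLabel w x = cycleLabel w y) : w.SameCycle x y := by
  unfold cycleLabel at h
  split_ifs at h with hx hy hy
  · rw [Sum.inr.inj h]
  · have h' := Sum.inl.inj h
    have hxs : x ∈ (w.cycleOf x).support :=
      Equiv.Perm.mem_support_cycleOf_iff' hx |>.2 (Equiv.Perm.SameCycle.refl _ _)
    rw [h'] at hxs
    exact ((Equiv.Perm.mem_support_cycleOf_iff' hy).1 hxs).symm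

theorem card_image_cycleLabel {n : ℕ} (w : Equiv.Perm (Fin n)) :
    (Finset.univ.image (cycleLabel w)).card = numCycles w := by
  have h : Finset.univ.image (cycleLabel w) =
      w.cycleFactorsFinset.disjSum (Finset.univ.filter fun i => w i = i) := by
    ext (c | i)
    · simp only [Finset.mem_image, Finset.mem_univ, true_and, Finset.inl_mem_disjSum]
      constructor
      · rintro ⟨x, hx⟩
        unfold cycleLabel at hx
        split_ifs at hx with h
        rw [← Sum.inl.inj hx, Equiv.Perm.cycleOf_mem_cycleFactorsFinset_iff]
        simpa using h
      · intro hc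
        obtain ⟨x, hx⟩ := (Equiv.Perm.mem_cycleFactorsFinset_iff.1 hc).1.nonempty_support
        refine ⟨x, ?_⟩
        have hwx := Equiv.Perm.mem_support.1 (Equiv.Perm.mem_cycleFactorsFinset_support_le hc hx)
        simp [cycleLabel, hwx, Equiv.Perm.cycle_is_cycleOf hx hc]
    · simp only [Finset.mem_image, Finset.mem_univ, true_and, Finset.inr_mem_disjSum,
        Finset.mem_filter]
      constructor
      · rintro ⟨x, hx⟩
        unfold cycleLabel at hx
        split_ifs at hx with h
        rwa [← Sum.inr.inj hx]
      · intro hi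
        exact ⟨i, by simp [cycleLabel, hi]⟩
  rw [h, Finset.card_disjSum, numCycles, Equiv.Perm.cycleType_def]
  simp

/-- A function that is constant on the cycles of `w` takes at most `numCycles w` values. -/
theorem card_image_le_numCycles {n : ℕ} {β : Type*} [DecidableEq β] (w : Equiv.Perm (Fin n))
    (g : Fin n → β) (hg : ∀ x, g (w x) = g x) : (Finset.univ.image g).card ≤ numCycles w := by
  have hconst : ∀ x y, w.SameCycle x y → g x = g y := by
    intro x y hxy
    obtain ⟨i, -, -, hi⟩ := hxy.exists_pow_eq
    rw [← hi]
    clear hi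
    induction i with
    | zero => rfl
    | succ k ih => rw [pow_succ', Equiv.Perm.mul_apply, hg, ih]
  rw [← card_image_cycleLabel w]
  choose r hr using fun (c : Equiv.Perm (Fin n) ⊕ Fin n)
    (hc : c ∈ Finset.univ.image (cycleLabel w)) => Finset.mem_image.1 hc
  rw [← Finset.card_attach (s := Finset.univ.image (cycleLabel w))]
  refine Finset.card_le_card_of_surjOn (fun c => g (r c.1 c.2)) ?_
  intro b hb
  obtain ⟨x, -, rfl⟩ := Finset.mem_image.1 (Finset.mem_coe.1 hb)
  have hx : cycleLabel w x ∈ Finset.univ.image (cycleLabel w) :=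
    Finset.mem_image_of_mem _ (Finset.mem_univ x)
  exact ⟨⟨_, hx⟩, Finset.mem_attach _ _, hconst _ _ (sameCycle_of_cycleLabel_eq (hr _ hx).2)⟩

theorem invLen_eq_sum {n : ℕ} (w : Equiv.Perm (Fin n)) :
    invLen w = ∑ a : Fin n, ∑ b : Fin n, if a < b ∧ w b < w a then 1 else 0 := by
  rw [invLen, Finset.card_filter, Fintype.sum_prod_type]

theorem invLen_succ {n : ℕ} (w : Equiv.Perm (Fin (n + 1))) :
    invLen w = (∑ a : Fin n, ∑ b : Fin n, if a < b ∧ w b.castSucc < w a.castSucc then 1 else 0) +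
      ∑ a : Fin n, if w (Fin.last n) < w a.castSucc then 1 else 0 := by
  simp only [invLen_eq_sum, Fin.sum_univ_castSucc, Fin.castSucc_lt_last, Finset.sum_add_distrib,
    not_lt_of_ge (Fin.le_last _), Fin.castSucc_lt_castSucc_iff, true_and, false_and, if_false,
    Finset.sum_const_zero, add_zero]

section FixedLast

variable {n : ℕ} {w : Equiv.Perm (Fin (n + 1))} {v : Equiv.Perm (Fin n)}

theorem invLen_of_fixes_last (hl : w (Fin.last n) = Fin.last n)
    (hv : ∀ i, w i.castSucc = (v i).castSucc) : invLen w = invLen v := by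
  rw [invLen_succ, invLen_eq_sum]
  simp [hl, hv, not_lt_of_ge (Fin.le_last _)]

theorem totalDisp_of_fixes_last (hl : w (Fin.last n) = Fin.last n)
    (hv : ∀ i, w i.castSucc = (v i).castSucc) : totalDisp w = totalDisp v := by
  simp [totalDisp, Fin.sum_univ_castSucc, hl, hv]

theorem reflLen_le_of_fixes_last (hl : w (Fin.last n) = Fin.last n)
    (hv : ∀ i, w i.castSucc = (v i).castSucc) : reflLen w ≤ reflLen v := by
  have h := card_image_le_numCycles w
    (Fin.lastCases none fun i => some (cycleLabel v i)) (by
      intro x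
      induction x using Fin.lastCases with
      | last => rw [hl]
      | cast i => simp [hv, cycleLabel_apply])
  have h' : Finset.univ.image (Fin.lastCases none fun i => some (cycleLabel v i) :
      Fin (n + 1) → Option (Equiv.Perm (Fin n) ⊕ Fin n)) =
      (Finset.univ.image (cycleLabel v)).insertNone := by
    ext (_ | c)
    · simpa using ⟨Fin.last n, by simp⟩
    · simp [Fin.exists_fin_succ']
  rw [h', Finset.card_insertNone, card_image_cycleLabel] at h
  unfold reflLen
  omega

end FixedLast

section MovedLast

variable {n : ℕ} {w : Equiv.Perm (Fin (n + 1))} {v : Equiv.Perm (Fin n)} {j : Fin n}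

theorem reflLen_le_of_moves_last (hj : w j.castSucc = Fin.last n)
    (hl : w (Fin.last n) = (v j).castSucc)
    (hv : ∀ i, i ≠ j → w i.castSucc = (v i).castSucc) : reflLen w ≤ reflLen v + 1 := by
  have h := card_image_le_numCycles w
    (Fin.lastCases (cycleLabel v j) fun i => cycleLabel v i) (by
      intro x
      induction x using Fin.lastCases with
      | last => simp [hl, cycleLabel_apply]
      | cast i =>
        by_cases hij : i = j
        · subst hij; simp [hj]
        · simp [hv i hij, cycleLabel_apply])
  have h' : Finset.univ.image (cycleLabel v) ⊆ Finset.univ.image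
      (Fin.lastCases (cycleLabel v j) fun i => cycleLabel v i :
      Fin (n + 1) → Equiv.Perm (Fin n) ⊕ Fin n) := by
    intro c hc
    obtain ⟨x, -, rfl⟩ := Finset.mem_image.1 hc
    exact Finset.mem_image.2 ⟨x.castSucc, Finset.mem_univ _, by simp⟩
  have h'' := (Finset.card_le_card h').trans h
  rw [card_image_cycleLabel] at h''
  unfold reflLen
  omega

theorem totalDisp_of_moves_last (hj : w j.castSucc = Fin.last n)
    (hl : w (Fin.last n) = (v j).castSucc)
    (hv : ∀ i, i ≠ j → w i.castSucc = (v i).castSucc) :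
    totalDisp w + 2 * max (j : ℕ) (v j) = totalDisp v + 2 * n := by
  unfold totalDisp
  rw [Fin.sum_univ_castSucc, ← Finset.add_sum_erase _ _ (Finset.mem_univ j),
    ← Finset.add_sum_erase (a := j) _ (fun i : Fin n => ((v i : ℤ) - (i : ℤ)).natAbs)
      (Finset.mem_univ j)]
  have h : ∑ i ∈ Finset.univ.erase j,
      ((w i.castSucc : ℤ) - (i.castSucc : ℤ)).natAbs =
      ∑ i ∈ Finset.univ.erase j, ((v i : ℤ) - (i : ℤ)).natAbs :=
    Finset.sum_congr rfl fun i hi => by simp [hv i (Finset.ne_of_mem_erase hi)]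
  rw [h, hj, hl]
  have h1 := j.isLt
  have h2 := (v j).isLt
  simp only [Fin.val_last, Fin.val_castSucc]
  omega

theorem invLen_of_moves_last (hj : w j.castSucc = Fin.last n)
    (hl : w (Fin.last n) = (v j).castSucc)
    (hv : ∀ i, i ≠ j → w i.castSucc = (v i).castSucc) :
    invLen w = invLen v + 1 + 2 * (Finset.univ.filter fun b => j < b ∧ v j < v b).card := by
  have h1 : ∀ a b : Fin n,
      (if a < b ∧ w b.castSucc < w a.castSucc then 1 else 0) +
        (if b = j then if a < j ∧ v j < v a then 1 else 0 else 0) =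
      (if a < b ∧ v b < v a then 1 else 0) +
        (if a = j then if j < b ∧ v j < v b then 1 else 0 else 0) := by
    intro a b
    by_cases ha : a = j
    · subst ha
      by_cases hb : b = a
      · subst hb; simp
      · have hne : v b ≠ v a := fun e => hb (v.injective e)
        simp only [hj, hv b hb, Fin.castSucc_lt_last, if_neg hb, if_true, and_true]
        grind
    · by_cases hb : b = j
      · subst hb
        simp [ha, hj, not_lt_of_ge (Fin.le_last _)]
      · simp [ha, hb, hv a ha, hv b hb]
  have h2 := Finset.sum_congr (rfl : (Finset.univ : Finset (Fin n)) = _) fun a _ =>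
    Finset.sum_congr (rfl : (Finset.univ : Finset (Fin n)) = _) fun b _ => h1 a b
  simp only [Finset.sum_add_distrib, Finset.sum_ite_eq', Finset.mem_univ, if_true] at h2
  rw [Finset.sum_comm (f := fun a b => if a = j then _ else _)] at h2
  simp only [Finset.sum_ite_eq', Finset.mem_univ, if_true] at h2
  have h3 : ∀ a : Fin n, (if w (Fin.last n) < w a.castSucc then 1 else 0) =
      (if a < j ∧ v j < v a then 1 else 0) + (if j < a ∧ v j < v a then 1 else 0) +
        (if a = j then 1 else 0) := by
    intro a
    by_cases ha : a = j
    · subst ha; simp [hl, hj, Fin.castSucc_lt_last]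
    · rw [hl, hv a ha]
      simp only [Fin.castSucc_lt_castSucc_iff]
      grind
  rw [invLen_succ, Finset.sum_congr rfl fun a _ => h3 a, invLen_eq_sum, Finset.card_filter]
  simp only [Finset.sum_add_distrib, Finset.sum_ite_eq', Finset.mem_univ, if_true]
  omega

end MovedLast

section Corner

variable {n : ℕ} (v : Equiv.Perm (Fin n)) (j : Fin n)

theorem card_greater_after_add_position_lt :
    (Finset.univ.filter fun b => j < b ∧ v j < v b).card + j + 1 ≤ n := by
  have h : (Finset.univ.filter fun b => j < b ∧ v j < v b) ⊆ Finset.Ioi j := by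
    intro b; simp +contextual
  have h' := Finset.card_le_card h
  rw [Fin.card_Ioi] at h'
  omega

theorem card_filter_apply_gt : (Finset.univ.filter fun b => v j < v b).card = n - 1 - v j := by
  rw [← Fin.card_Ioi]
  exact Finset.card_equiv v (by simp)

theorem card_greater_after_add_value_lt :
    (Finset.univ.filter fun b => j < b ∧ v j < v b).card + v j + 1 ≤ n := by
  have h : (Finset.univ.filter fun b => j < b ∧ v j < v b) ⊆
      Finset.univ.filter fun b => v j < v b := by
    intro b; simp +contextual
  have h' := Finset.card_le_card h
  rw [card_filter_apply_gt] at h'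
  omega

variable {v j}

theorem rightToLeftMinAt_of_card
    (hc : (Finset.univ.filter fun b => j < b ∧ v j < v b).card + j + 1 = n) :
    RightToLeftMinAt v j := by
  have h : (Finset.univ.filter fun b => j < b ∧ v j < v b) = Finset.Ioi j :=
    Finset.eq_of_subset_of_card_le (by intro b; simp +contextual) (by rw [Fin.card_Ioi]; omega)
  intro i hi
  rw [← Finset.mem_Ioi, ← h] at hi
  exact (Finset.mem_filter.1 hi).2.2

theorem leftToRightMaxAt_of_card
    (hc : (Finset.univ.filter fun b => j < b ∧ v j < v b).card + v j + 1 = n) :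
    LeftToRightMaxAt v j := by
  have h : (Finset.univ.filter fun b => j < b ∧ v j < v b) =
      Finset.univ.filter fun b => v j < v b :=
    Finset.eq_of_subset_of_card_le (by intro b; simp +contextual)
      (by rw [card_filter_apply_gt]; omega)
  intro i hi
  by_contra hlt
  have hne : v j ≠ v i := fun e => hi.ne' (v.injective e)
  have hm : i ∈ Finset.univ.filter fun b => v j < v b := by
    simpa using lt_of_le_of_ne (not_lt.1 hlt) hne
  rw [← h] at hm
  exact hi.asymm (Finset.mem_filter.1 hm).2.1

end Corner

section Restrict

variable {n : ℕ} (w : Equiv.Perm (Fin (n + 1)))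

/-- Removing the largest element `n` from its cycle in `w`. -/
def removeLast : Equiv.Perm (Fin n) :=
  Equiv.removeNone (finSuccEquivLast.symm.trans (w.trans finSuccEquivLast))

theorem apply_castSucc_eq_castSucc_removeLast {i : Fin n} (h : w i.castSucc ≠ Fin.last n) :
    w i.castSucc = (removeLast w i).castSucc := by
  obtain ⟨k, hk⟩ := Fin.exists_castSucc_eq.2 h
  have h' := Equiv.removeNone_some (finSuccEquivLast.symm.trans (w.trans finSuccEquivLast))
    (x := i) ⟨k, by simp [← hk]⟩
  apply finSuccEquivLast.injective
  rw [finSuccEquivLast_castSucc]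
  simpa [removeLast] using h'.symm

theorem apply_last_eq_castSucc_removeLast {j : Fin n} (h : w j.castSucc = Fin.last n) :
    w (Fin.last n) = (removeLast w j).castSucc := by
  have h' := Equiv.removeNone_none (finSuccEquivLast.symm.trans (w.trans finSuccEquivLast))
    (x := j) (by simp [h])
  apply finSuccEquivLast.injective
  rw [finSuccEquivLast_castSucc]
  simpa [removeLast] using h'.symm

theorem apply_castSucc_of_fixes_last (h : w (Fin.last n) = Fin.last n) (i : Fin n) :
    w i.castSucc = (removeLast w i).castSucc :=
  apply_castSucc_eq_castSucc_removeLast w fun e =>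
    (Fin.castSucc_lt_last i).ne (w.injective (e.trans h.symm))

theorem apply_castSucc_of_moves_last {j : Fin n} (h : w j.castSucc = Fin.last n) (i : Fin n)
    (hi : i ≠ j) : w i.castSucc = (removeLast w i).castSucc :=
  apply_castSucc_eq_castSucc_removeLast w fun e =>
    hi (Fin.castSucc_injective n (w.injective (e.trans h.symm)))

theorem exists_apply_castSucc_eq_last (h : w (Fin.last n) ≠ Fin.last n) :
    ∃ j : Fin n, w j.castSucc = Fin.last n := by
  obtain ⟨j, hj⟩ := Fin.exists_castSucc_eq.2 (show w⁻¹ (Fin.last n) ≠ Fin.last n from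
    fun e => h (by rw [Equiv.Perm.inv_eq_iff_eq] at e; exact e.symm))
  exact ⟨j, by simp [hj]⟩

end Restrict

/-- The Diaconis–Graham inequality. -/
theorem invLen_add_reflLen_le_totalDisp {n : ℕ} (w : Equiv.Perm (Fin n)) :
    invLen w + reflLen w ≤ totalDisp w := by
  induction n with
  | zero => simp [invLen, reflLen]
  | succ n ih =>
    have hi := ih (removeLast w)
    by_cases h : w (Fin.last n) = Fin.last n
    · have hv := apply_castSucc_of_fixes_last w h
      have := reflLen_le_of_fixes_last h hv
      rw [invLen_of_fixes_last h hv, totalDisp_of_fixes_last h hv]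
      omega
    · obtain ⟨j, hj⟩ := exists_apply_castSucc_eq_last w h
      have hl := apply_last_eq_castSucc_removeLast w hj
      have hv := apply_castSucc_of_moves_last w hj
      have := reflLen_le_of_moves_last hj hl hv
      have := totalDisp_of_moves_last hj hl hv
      have := invLen_of_moves_last hj hl hv
      have := card_greater_after_add_position_lt (removeLast w) j
      have := card_greater_after_add_value_lt (removeLast w) j
      omega

/-- Hadjicostas–Monico recursion (forward direction): if `n ≥ 2` and `w` is shallow, then
either `w(n) = n` and the restriction `w'` of `w` to `{1,…,n-1}` is shallow, or
`w(n) = k ≠ n`, `j = w⁻¹(n)`, and the permutation `w'` of `{1,…,n-1}` agreeing with `w`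
away from `j` and with `w'(j) = k` is shallow with a left-to-right maximum or a
right-to-left minimum at `j`. -/
theorem shallow_recursion {n : ℕ} (hn : 1 ≤ n) (w : Equiv.Perm (Fin (n + 1)))
    (hw : IsShallow w) :
    (w (Fin.last n) = Fin.last n ∧
      ∃ w' : Equiv.Perm (Fin n),
        (∀ i : Fin n, (w' i : ℕ) = (w i.castSucc : ℕ)) ∧ IsShallow w')
    ∨ (w (Fin.last n) ≠ Fin.last n ∧
      ∃ (j : Fin n) (w' : Equiv.Perm (Fin n)),
        j.castSucc = w⁻¹ (Fin.last n) ∧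
        (∀ i : Fin n, i ≠ j → (w' i : ℕ) = (w i.castSucc : ℕ)) ∧
        (w' j : ℕ) = (w (Fin.last n) : ℕ) ∧
        IsShallow w' ∧
        (LeftToRightMaxAt w' j ∨ RightToLeftMinAt w' j)) := by
  have hi := invLen_add_reflLen_le_totalDisp (removeLast w)
  unfold IsShallow at *
  by_cases h : w (Fin.last n) = Fin.last n
  · have hv := apply_castSucc_of_fixes_last w h
    refine Or.inl ⟨h, removeLast w, fun i => by simp [hv i], ?_⟩
    have := reflLen_le_of_fixes_last h hv
    rw [invLen_of_fixes_last h hv, totalDisp_of_fixes_last h hv] at hw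
    omega
  · obtain ⟨j, hj⟩ := exists_apply_castSucc_eq_last w h
    have hl := apply_last_eq_castSucc_removeLast w hj
    have hv := apply_castSucc_of_moves_last w hj
    have := reflLen_le_of_moves_last hj hl hv
    have := totalDisp_of_moves_last hj hl hv
    have := invLen_of_moves_last hj hl hv
    have := card_greater_after_add_position_lt (removeLast w) j
    have := card_greater_after_add_value_lt (removeLast w) j
    refine Or.inr ⟨h, j, removeLast w, ?_, fun i hij => by simp [hv i hij], by simp [hl],
      by omega, ?_⟩
    · exact (Equiv.Perm.inv_eq_iff_eq.2 hj.symm).symm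
    · rcases le_total (j : ℕ) (removeLast w j) with hle | hle
      · exact Or.inl (leftToRightMaxAt_of_card (by omega))
      · exact Or.inr (rightToLeftMinAt_of_card (by omega))
end
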